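/- Let C_A ⊆ F₂^A and C_B ⊆ F₂^B be linear codes of length Δ = |A| = |B| with minimum distances d_A and d_B. Let c be a codeword of the dual tensor code C_A ⊗ F₂^B + F₂^A ⊗ C_B of Hamming weight w. If there exist A₀ ⊆ A with |A₀| ≤ d_A/2 and B₀ ⊆ B with |B₀| ≤ d_B/2 such that c_{ab} = 0 whenever a ∉ A₀ and b ∉ B₀, then there exist A' ⊆ A with |A'| ≤ w/d_B and B' ⊆ B with |B'| ≤ w/d_A such that c_{ab} = 0 whenever a ∉ A' and b ∉ B'. -/

import Mathlib

noncomputable section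

/-- Hamming weight of a binary word. -/
def wt {ι : Type*} (x : ι → ZMod 2) : ℕ := {i | x i ≠ 0}.ncard

/-- Hamming distance from a word to a set of words. -/
def distTo {ι : Type*} (x : ι → ZMod 2) (S : Set (ι → ZMod 2)) : ℕ :=
  sInf {d : ℕ | ∃ c ∈ S, wt (x - c) = d}

/-- Minimum distance of a linear code. -/
def minDist {ι : Type*} (C : Submodule (ZMod 2) (ι → ZMod 2)) : ℕ :=
  sInf {d : ℕ | ∃ c ∈ C, c ≠ 0 ∧ wt c = d}

/-- Dual code with respect to the standard bilinear form. -/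
def dualCode {ι : Type*} [Finite ι] (C : Submodule (ZMod 2) (ι → ZMod 2)) :
    Submodule (ZMod 2) (ι → ZMod 2) :=
  letI := Fintype.ofFinite ι
  { carrier := {x | ∀ c ∈ C, ∑ i, x i * c i = 0}
    add_mem' := by
      intro x y hx hy c hc
      have h : ∑ i, (x + y) i * c i = (∑ i, x i * c i) + ∑ i, y i * c i := by
        simp [add_mul, Finset.sum_add_distrib]
      simp only [Set.mem_setOf_eq] at *
      rw [h, hx c hc, hy c hc, add_zero]
    zero_mem' := by
      simp
    smul_mem' := by
      intro t x hx c hc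
      have h : ∑ i, (t • x) i * c i = t * ∑ i, x i * c i := by
        simp [Finset.mul_sum, mul_assoc]
      simp only [Set.mem_setOf_eq] at *
      rw [h, hx c hc, mul_zero] }

/-- The code of matrices all of whose columns lie in `CA`. -/
def colCode {A : Type*} (B : Type*) (CA : Submodule (ZMod 2) (A → ZMod 2)) :
    Submodule (ZMod 2) (A × B → ZMod 2) where
  carrier := {x | ∀ b : B, (fun a => x (a, b)) ∈ CA}
  add_mem' := by intro x y hx hy b; exact CA.add_mem (hx b) (hy b)
  zero_mem' := by intro b; exact CA.zero_mem
  smul_mem' := by intro t x hx b; exact CA.smul_mem t (hx b)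

/-- The code of matrices all of whose rows lie in `CB`. -/
def rowCode (A : Type*) {B : Type*} (CB : Submodule (ZMod 2) (B → ZMod 2)) :
    Submodule (ZMod 2) (A × B → ZMod 2) where
  carrier := {x | ∀ a : A, (fun b => x (a, b)) ∈ CB}
  add_mem' := by intro x y hx hy a; exact CB.add_mem (hx a) (hy a)
  zero_mem' := by intro a; exact CB.zero_mem
  smul_mem' := by intro t x hx a; exact CB.smul_mem t (hx a)

/-- Tensor code `C_A ⊗ C_B`. -/
def tensorCode {A B : Type*} (CA : Submodule (ZMod 2) (A → ZMod 2))
    (CB : Submodule (ZMod 2) (B → ZMod 2)) : Submodule (ZMod 2) (A × B → ZMod 2) :=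
  colCode B CA ⊓ rowCode A CB

/-- Dual tensor code `C_A ⊗ F₂^B + F₂^A ⊗ C_B`. -/
def dualTensor {A B : Type*} (CA : Submodule (ZMod 2) (A → ZMod 2))
    (CB : Submodule (ZMod 2) (B → ZMod 2)) : Submodule (ZMod 2) (A × B → ZMod 2) :=
  colCode B CA ⊔ rowCode A CB

/-- `w`-robustness of the dual tensor code of `CA` and `CB`. -/
def IsRobust {A B : Type*} (CA : Submodule (ZMod 2) (A → ZMod 2))
    (CB : Submodule (ZMod 2) (B → ZMod 2)) (w : ℝ) : Prop :=
  ∀ c ∈ dualTensor CA CB, (wt c : ℝ) ≤ w →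
    ∃ (A' : Set A) (B' : Set B),
      (A'.ncard : ℝ) ≤ (wt c : ℝ) / (minDist CB : ℝ) ∧
      (B'.ncard : ℝ) ≤ (wt c : ℝ) / (minDist CA : ℝ) ∧
      ∀ a b, a ∉ A' → b ∉ B' → c (a, b) = 0

/-- Punctured code: restrictions of codewords of `C` to the coordinates in `A'`. -/
def punct {A : Type*} (C : Submodule (ZMod 2) (A → ZMod 2)) (A' : Set A) :
    Submodule (ZMod 2) (↥A' → ZMod 2) :=
  C.map (LinearMap.funLeft (ZMod 2) (ZMod 2) ((↑) : ↥A' → A))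

/-- `w`-robustness with `p`-resistance to puncturing. -/
def IsRobustPunct {A B : Type*} [Finite A] [Finite B]
    (CA : Submodule (ZMod 2) (A → ZMod 2)) (CB : Submodule (ZMod 2) (B → ZMod 2))
    (w p : ℝ) : Prop :=
  ∀ (A' : Set A) (B' : Set B) (w' : ℕ), (w' : ℝ) ≤ p →
    A'.ncard + w' = Nat.card A → B'.ncard + w' = Nat.card B →
    IsRobust (punct CA A') (punct CB B') w

section Complex

variable {G : Type*} [Group G] [DecidableEq G]

/-- Total no-conjugacy condition. -/
def TNC (A B : Set G) : Prop := ∀ g : G, ∀ a ∈ A, ∀ b ∈ B, a * g ≠ g * b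

/-- The square associated to `(g, a, b)`. -/
def cpxSq (g a b : G) : Finset (G × Bool) :=
  {(g, false), (a * g, true), (g * b, true), (a * g * b, false)}

/-- The set `Q` of squares of the left-right Cayley complex. -/
def Squares (A B : Set G) : Set (Finset (G × Bool)) :=
  {q | ∃ g : G, ∃ a ∈ A, ∃ b ∈ B, q = cpxSq g a b}

/-- Local view of `x : F₂^Q` at the vertex `(g, 0) ∈ V₀`, as an element of `F₂^{A×B}`. -/
def lview0 (A B : Set G) (x : ↥(Squares A B) → ZMod 2) (g : G) :
    ↥A × ↥B → ZMod 2 :=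
  fun ab => x ⟨cpxSq g (ab.1 : G) (ab.2 : G), ⟨g, (ab.1 : G), ab.1.2, (ab.2 : G), ab.2.2, rfl⟩⟩

/-- Local view of `x : F₂^Q` at the vertex `(g, 1) ∈ V₁`, as an element of `F₂^{A×B}`. -/
def lview1 {A B : Set G} (hA : ∀ a ∈ A, a⁻¹ ∈ A) (x : ↥(Squares A B) → ZMod 2) (g : G) :
    ↥A × ↥B → ZMod 2 :=
  fun ab => x ⟨cpxSq ((ab.1 : G) * g) (ab.1 : G)⁻¹ (ab.2 : G),
    ⟨(ab.1 : G) * g, (ab.1 : G)⁻¹, hA _ ab.1.2, (ab.2 : G), ab.2.2, rfl⟩⟩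

/-- The classical code 𝒞₀ of the quantum Tanner code: all local views at
vertices of `V₀` lie in `C₀^⊥ = (C_A ⊗ C_B)^⊥`. -/
def qC0 [Finite G] (A B : Set G) (CA : Submodule (ZMod 2) (↥A → ZMod 2))
    (CB : Submodule (ZMod 2) (↥B → ZMod 2)) :
    Submodule (ZMod 2) (↥(Squares A B) → ZMod 2) where
  carrier := {x | ∀ g : G, lview0 A B x g ∈ dualCode (tensorCode CA CB)}
  add_mem' := by
    intro x y hx hy g
    exact (dualCode (tensorCode CA CB)).add_mem (hx g) (hy g)
  zero_mem' := by
    intro g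
    exact (dualCode (tensorCode CA CB)).zero_mem
  smul_mem' := by
    intro t x hx g
    exact (dualCode (tensorCode CA CB)).smul_mem t (hx g)

/-- The classical code 𝒞₁ of the quantum Tanner code: all local views at
vertices of `V₁` lie in `C₁^⊥ = (C_A^⊥ ⊗ C_B^⊥)^⊥`. -/
def qC1 [Finite G] {A B : Set G} (hA : ∀ a ∈ A, a⁻¹ ∈ A)
    (CA : Submodule (ZMod 2) (↥A → ZMod 2)) (CB : Submodule (ZMod 2) (↥B → ZMod 2)) :
    Submodule (ZMod 2) (↥(Squares A B) → ZMod 2) where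
  carrier := {x | ∀ g : G, lview1 hA x g ∈ dualCode (tensorCode (dualCode CA) (dualCode CB))}
  add_mem' := by
    intro x y hx hy g
    exact (dualCode (tensorCode (dualCode CA) (dualCode CB))).add_mem (hx g) (hy g)
  zero_mem' := by
    intro g
    exact (dualCode (tensorCode (dualCode CA) (dualCode CB))).zero_mem
  smul_mem' := by
    intro t x hx g
    exact (dualCode (tensorCode (dualCode CA) (dualCode CB))).smul_mem t (hx g)

/-- Adjacency matrix of the left Cayley graph `Cay(G, A)`. -/
def cayAdjL (A : Set G) : Matrix G G ℝ :=
  fun g g' => A.indicator (fun _ => (1 : ℝ)) (g' * g⁻¹)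

/-- Adjacency matrix of the right Cayley graph `Cay(G, B)`. -/
def cayAdjR (B : Set G) : Matrix G G ℝ :=
  fun g g' => B.indicator (fun _ => (1 : ℝ)) (g⁻¹ * g')

end Complex

/-- A `Δ`-regular graph (given by its adjacency matrix) is Ramanujan if every
eigenvalue other than `±Δ` has absolute value at most `2√(Δ-1)`. -/
def IsRamanujan {V : Type*} [Fintype V] (M : Matrix V V ℝ) (Δ : ℝ) : Prop :=
  ∀ μ : ℝ, (∃ x : V → ℝ, x ≠ 0 ∧ M.mulVec x = μ • x) → μ ≠ Δ → μ ≠ -Δ →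
    |μ| ≤ 2 * Real.sqrt (Δ - 1)

/-- Probability of the event `S` under the uniform distribution on a finite type. -/
def unifProb {Ω : Type*} [Fintype Ω] (S : Set Ω) : ℝ :=
  (S.ncard : ℝ) / (Fintype.card Ω : ℝ)

end

theorem eq_zero_of_wt_eq_zero {ι : Type*} [Finite ι] {v : ι → ZMod 2} (h : wt v = 0) :
    v = 0 := by
  have h' := (Set.ncard_eq_zero (Set.toFinite _)).1 h
  funext i
  by_contra hi
  exact (Set.eq_empty_iff_forall_notMem.1 h' i) hi

theorem minDist_le_wt {ι : Type*} {C : Submodule (ZMod 2) (ι → ZMod 2)} {v : ι → ZMod 2}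
    (hv : v ∈ C) (h0 : v ≠ 0) : minDist C ≤ wt v :=
  Nat.sInf_le ⟨v, hv, h0, rfl⟩

/-- A zero minimum distance is the default value, taken by the zero code only. -/
theorem minDist_pos_of_mem {ι : Type*} [Finite ι] {C : Submodule (ZMod 2) (ι → ZMod 2)}
    {v : ι → ZMod 2} (hv : v ∈ C) (h0 : v ≠ 0) : 0 < minDist C := by
  obtain ⟨u, -, hu0, hu⟩ := Nat.sInf_mem (s := {d : ℕ | ∃ c ∈ C, c ≠ 0 ∧ wt c = d})
    ⟨_, v, hv, h0, rfl⟩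
  refine Nat.pos_of_ne_zero fun h => hu0 (eq_zero_of_wt_eq_zero (hu.trans h))

/-- A codeword supported on at most half the minimum distance many coordinates vanishes. -/
theorem eq_zero_of_support_le_half {ι : Type*} [Finite ι]
    {C : Submodule (ZMod 2) (ι → ZMod 2)} {S : Set ι} (hS : 2 * S.ncard ≤ minDist C)
    {v : ι → ZMod 2} (hv : v ∈ C) (hvS : ∀ i, i ∉ S → v i = 0) : v = 0 := by
  by_contra h0
  have h1 := minDist_le_wt hv h0
  have h2 : wt v ≤ S.ncard :=
    Set.ncard_le_ncard (fun i hi => by_contra fun h => hi (hvS i h)) (Set.toFinite _)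
  have h3 := minDist_pos_of_mem hv h0
  omega

/-- If no nonzero codeword is supported on `S`, codewords can be decoded linearly from
their coordinates outside `S`. -/
theorem exists_linear_erasure_decoder {ι : Type*} (C : Submodule (ZMod 2) (ι → ZMod 2))
    (S : Set ι) (hS : ∀ v ∈ C, (∀ i, i ∉ S → v i = 0) → v = 0) :
    ∃ L : (ι → ZMod 2) →ₗ[ZMod 2] (ι → ZMod 2), (∀ v, L v ∈ C) ∧
      ∀ v, ∀ u ∈ C, (∀ i, i ∉ S → v i = u i) → L v = u := by
  let P := LinearMap.funLeft (ZMod 2) (ZMod 2) ((↑) : ↥Sᶜ → ι)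
  have hinj : LinearMap.ker (P ∘ₗ C.subtype) = ⊥ := by
    rw [LinearMap.ker_eq_bot']
    rintro ⟨v, hv⟩ h
    exact Subtype.ext (hS v hv fun i hi => congrFun h ⟨i, hi⟩)
  obtain ⟨g, hg⟩ := LinearMap.exists_leftInverse_of_injective _ hinj
  refine ⟨C.subtype ∘ₗ g ∘ₗ P, fun v => (g (P v)).2, fun v u hu h => ?_⟩
  have hP : P v = (P ∘ₗ C.subtype) ⟨u, hu⟩ := funext fun i => h i i.2
  have := LinearMap.congr_fun hg ⟨u, hu⟩
  simp only [LinearMap.comp_apply, LinearMap.id_apply] at this hP ⊢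
  rw [hP, this]
  rfl

/-- A matrix with rows in a code keeps its rows in the code when a linear map is applied to
all its columns. -/
theorem row_mem_of_map_columns {A B : Type*} [Finite A]
    {C : Submodule (ZMod 2) (B → ZMod 2)} (L : (A → ZMod 2) →ₗ[ZMod 2] (A → ZMod 2))
    {y : A × B → ZMod 2} (hy : y ∈ rowCode A C) (a : A) :
    (fun b => L (fun a' => y (a', b)) a) ∈ C := by
  classical
  have := Fintype.ofFinite A
  have h : (fun b => L (fun a' => y (a', b)) a) =
      ∑ a', L (Pi.single a' 1) a • fun b => y (a', b) := by
    funext b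
    rw [LinearMap.pi_apply_eq_sum_univ L (fun a' => y (a', b))]
    simp only [Finset.sum_apply, Pi.smul_apply, smul_eq_mul]
    refine Finset.sum_congr rfl fun a' _ => ?_
    rw [mul_comm]
    congr 2
    refine congrFun (congrArg L (funext fun j => ?_)) a
    simp [Pi.single_apply, eq_comm]
  rw [h]
  exact C.sum_mem fun a' _ => C.smul_mem _ (hy a')

/-- A dual tensor codeword supported on few rows `A₀` and few columns `B₀` is the sum of a
matrix with columns in `CA` supported on `B₀` and one with rows in `CB` supported on `A₀`. -/
theorem exists_supported_decomposition {A B : Type*} [Finite A] [Finite B]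
    {CA : Submodule (ZMod 2) (A → ZMod 2)} {CB : Submodule (ZMod 2) (B → ZMod 2)}
    {c : A × B → ZMod 2} (hc : c ∈ dualTensor CA CB) {A₀ : Set A} {B₀ : Set B}
    (hA₀ : 2 * A₀.ncard ≤ minDist CA) (hB₀ : 2 * B₀.ncard ≤ minDist CB)
    (hsupp : ∀ a b, a ∉ A₀ → b ∉ B₀ → c (a, b) = 0) :
    ∃ x ∈ colCode B CA, ∃ y ∈ rowCode A CB, x + y = c ∧
      (∀ a b, b ∉ B₀ → x (a, b) = 0) ∧ ∀ a b, a ∉ A₀ → y (a, b) = 0 := by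
  obtain ⟨x, hx, y, hy, rfl⟩ := Submodule.mem_sup.1 hc
  obtain ⟨L, hL, hLC⟩ := exists_linear_erasure_decoder CA A₀
    fun v hv h => eq_zero_of_support_le_half hA₀ hv h
  let t : A × B → ZMod 2 := fun p => L (fun a => (-y) (a, p.2)) p.1
  have htx : ∀ a b, b ∉ B₀ → t (a, b) = x (a, b) := fun a b hb =>
    congrFun (hLC _ (fun a => x (a, b)) (hx b) fun i hi =>
      neg_eq_of_add_eq_zero_left (hsupp i b hi hb)) a
  have htcol : t ∈ colCode B CA := fun b => hL (fun a => (-y) (a, b))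
  have htrow : t ∈ rowCode A CB := row_mem_of_map_columns L (neg_mem hy)
  have hyt : y + t ∈ rowCode A CB := add_mem hy htrow
  refine ⟨x - t, sub_mem hx htcol, y + t, hyt, by abel, fun a b hb => ?_,
    fun a b ha => ?_⟩
  · simp [htx a b hb]
  · refine congrFun (eq_zero_of_support_le_half hB₀ (hyt a) fun b hb => ?_) b
    have := hsupp a b ha hb
    simp only [Pi.add_apply] at this ⊢
    rw [htx a b hb, add_comm, this]

theorem wt_eq_card_filter {ι : Type*} [Fintype ι] (v : ι → ZMod 2) :
    wt v = (Finset.univ.filter fun i => v i ≠ 0).card := by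
  rw [wt, ← Set.ncard_coe_finset]
  simp

/-- Weight outside of `T` of a family of nonzero codewords. -/
theorem card_mul_minDist_le {ι κ : Type*} [Fintype ι] [DecidableEq ι]
    {C : Submodule (ZMod 2) (ι → ZMod 2)} (S : Finset κ) (T : Finset ι)
    {y : κ → ι → ZMod 2} (hy : ∀ k ∈ S, y k ∈ C) (h0 : ∀ k ∈ S, y k ≠ 0) :
    S.card * minDist C ≤
      ∑ k ∈ S, (Tᶜ.filter fun i => y k i ≠ 0).card + S.card * T.card := by
  rw [← smul_eq_mul, ← smul_eq_mul, ← Finset.sum_const, ← Finset.sum_const,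
    ← Finset.sum_add_distrib]
  refine Finset.sum_le_sum fun k hk => (minDist_le_wt (hy k hk) (h0 k hk)).trans ?_
  rw [wt_eq_card_filter]
  refine le_trans (Finset.card_le_card fun i hi => ?_) (Finset.card_union_le _ _)
  by_cases hT : i ∈ T <;> simp_all

/-- The parts of a matrix in `S × Tᶜ` and in `Sᶜ × T` contribute separately to its weight. -/
theorem sum_card_add_sum_card_le_wt {A B : Type*} [Fintype A] [Fintype B] [DecidableEq A]
    [DecidableEq B] (c : A × B → ZMod 2) (S : Finset A) (T : Finset B) :
    ∑ a ∈ S, (Tᶜ.filter fun b => c (a, b) ≠ 0).card +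
      ∑ b ∈ T, (Sᶜ.filter fun a => c (a, b) ≠ 0).card ≤ wt c := by
  have h1 : ((S ×ˢ Tᶜ).filter fun p => c p ≠ 0).card =
      ∑ a ∈ S, (Tᶜ.filter fun b => c (a, b) ≠ 0).card := by
    simp only [Finset.card_filter, Finset.sum_product]
  have h2 : ((Sᶜ ×ˢ T).filter fun p => c p ≠ 0).card =
      ∑ b ∈ T, (Sᶜ.filter fun a => c (a, b) ≠ 0).card := by
    simp only [Finset.card_filter, Finset.sum_product_right]
  rw [← h1, ← h2, wt_eq_card_filter, ← Finset.card_union_of_disjoint]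
  · exact Finset.card_le_card fun p hp => by simp at hp ⊢; tauto
  · rw [Finset.disjoint_left]
    intro p hp hq
    simp at hp hq
    tauto

theorem natCast_le_div_of_mul_le {m d w : ℕ} (h : m * d ≤ w) (h0 : m ≠ 0 → 0 < d) :
    (m : ℝ) ≤ (w : ℝ) / (d : ℝ) := by
  rcases Nat.eq_zero_or_pos m with rfl | hm
  · rw [Nat.cast_zero]
    positivity
  · rw [le_div_iff₀ (by exact_mod_cast h0 hm.ne')]
    exact_mod_cast h

/-- Lemma 12: a dual tensor codeword of weight `w` supported on at
most `d_A/2` rows and `d_B/2` columns is supported on at most `w/d_B` rows and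
`w/d_A` columns. -/
theorem dual_tensor_support_refinement
    {A B : Type*} [Finite A] [Finite B] (Δ : ℕ)
    (hcA : Nat.card A = Δ) (hcB : Nat.card B = Δ)
    (CA : Submodule (ZMod 2) (A → ZMod 2)) (CB : Submodule (ZMod 2) (B → ZMod 2))
    (c : A × B → ZMod 2) (hc : c ∈ dualTensor CA CB) (w : ℕ) (hw : wt c = w)
    (A₀ : Set A) (B₀ : Set B)
    (hA₀ : (A₀.ncard : ℝ) ≤ (minDist CA : ℝ) / 2)
    (hB₀ : (B₀.ncard : ℝ) ≤ (minDist CB : ℝ) / 2)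
    (hsupp : ∀ a b, a ∉ A₀ → b ∉ B₀ → c (a, b) = 0) :
    ∃ (A' : Set A) (B' : Set B),
      (A'.ncard : ℝ) ≤ (w : ℝ) / (minDist CB : ℝ) ∧
      (B'.ncard : ℝ) ≤ (w : ℝ) / (minDist CA : ℝ) ∧
      ∀ a b, a ∉ A' → b ∉ B' → c (a, b) = 0 := by
  classical
  have := Fintype.ofFinite A
  have := Fintype.ofFinite B
  have hA : 2 * A₀.ncard ≤ minDist CA := by
    have : (A₀.ncard : ℝ) * 2 ≤ minDist CA := by linarith
    rw [mul_comm]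
    exact_mod_cast this
  have hB : 2 * B₀.ncard ≤ minDist CB := by
    have : (B₀.ncard : ℝ) * 2 ≤ minDist CB := by linarith
    rw [mul_comm]
    exact_mod_cast this
  obtain ⟨x, hx, y, hy, hxy, hx0, hy0⟩ := exists_supported_decomposition hc hA hB hsupp
  let S : Finset A := Finset.univ.filter fun a => (fun b => y (a, b)) ≠ 0
  let T : Finset B := Finset.univ.filter fun b => (fun a => x (a, b)) ≠ 0
  have hyS : ∀ a, a ∉ S → ∀ b, y (a, b) = 0 := fun a ha b =>
    congrFun (not_not.1 fun h => ha (by simpa [S] using h)) b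
  have hxT : ∀ b, b ∉ T → ∀ a, x (a, b) = 0 := fun b hb a =>
    congrFun (not_not.1 fun h => hb (by simpa [T] using h)) a
  have hS0 : ∀ a ∈ S, (fun b => y (a, b)) ≠ 0 := fun a ha => (Finset.mem_filter.1 ha).2
  have hT0 : ∀ b ∈ T, (fun a => x (a, b)) ≠ 0 := fun b hb => (Finset.mem_filter.1 hb).2
  have hSA : S.card ≤ A₀.ncard := by
    rw [← Set.ncard_coe_finset]
    exact Set.ncard_le_ncard
      (fun a ha => by_contra fun h => hS0 a ha (funext fun b => hy0 a b h)) (Set.toFinite _)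
  have hTB : T.card ≤ B₀.ncard := by
    rw [← Set.ncard_coe_finset]
    exact Set.ncard_le_ncard
      (fun b hb => by_contra fun h => hT0 b hb (funext fun a => hx0 a b h)) (Set.toFinite _)
  have hrow := card_mul_minDist_le S T (fun a _ => hy a) hS0
  have hcol := card_mul_minDist_le T S (fun b _ => hx b) hT0
  have hsum := sum_card_add_sum_card_le_wt c S T
  have hF : ∑ a ∈ S, (Tᶜ.filter fun b => c (a, b) ≠ 0).card =
      ∑ a ∈ S, (Tᶜ.filter fun b => y (a, b) ≠ 0).card :=
    Finset.sum_congr rfl fun a _ => congrArg _ <| Finset.filter_congr fun b hb => by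
      simp [← hxy, hxT b (Finset.mem_compl.1 hb) a]
  have hG : ∑ b ∈ T, (Sᶜ.filter fun a => c (a, b) ≠ 0).card =
      ∑ b ∈ T, (Sᶜ.filter fun a => x (a, b) ≠ 0).card :=
    Finset.sum_congr rfl fun b _ => congrArg _ <| Finset.filter_congr fun a ha => by
      simp [← hxy, hyS a (Finset.mem_compl.1 ha) b]
  rw [hF, hG, hw] at hsum
  have hSd : T.card * (2 * S.card) ≤ T.card * minDist CA := by gcongr; omega
  have hTd : S.card * (2 * T.card) ≤ S.card * minDist CB := by gcongr; omega
  refine ⟨S, T, ?_, ?_, fun a b ha hb => ?_⟩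
  · rw [Set.ncard_coe_finset]
    refine natCast_le_div_of_mul_le (by nlinarith) fun h => ?_
    obtain ⟨a, ha⟩ := Finset.card_ne_zero.1 h
    exact minDist_pos_of_mem (hy a) (hS0 a ha)
  · rw [Set.ncard_coe_finset]
    refine natCast_le_div_of_mul_le (by nlinarith) fun h => ?_
    obtain ⟨b, hb⟩ := Finset.card_ne_zero.1 h
    exact minDist_pos_of_mem (hx b) (hT0 b hb)
  · simp [← hxy, hxT b (by simpa using hb) a, hyS a (by simpa using ha) b]
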